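/- Let p be an odd prime. The determinant homomorphism det : GL₂(ℤ_p) → ℤ_pˣ is surjective and its kernel is the commutator subgroup of GL₂(ℤ_p); hence det induces a group isomorphism from the abelianisation of GL₂(ℤ_p) onto ℤ_pˣ. -/

import Mathlib

open scoped MatrixGroups

open scoped commutatorElement in
/-- An element `g` with `x * y = g * (y * x)` is the commutator of `x` and `y`. -/
lemma mem_commutator_of_mul_eq {G : Type*} [Group G] {g x y : G} (h : x * y = g * (y * x)) :
    g ∈ commutator G := by
  have hg : g = ⁅x, y⁆ := by
    rw [commutatorElement_def, h]
    group
  rw [hg]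
  exact Subgroup.commutator_mem_commutator (Subgroup.mem_top _) (Subgroup.mem_top _)

section GL2

variable {R : Type*} [CommRing R]

lemma GL2_upper_mem_commutator (h2 : IsUnit (2 : R)) (g : GL (Fin 2) R) (c : R)
    (hg : (g : Matrix (Fin 2) (Fin 2) R) = !![1, c; 0, 1]) :
    g ∈ commutator (GL (Fin 2) R) := by
  refine mem_commutator_of_mul_eq
    (x := Matrix.GeneralLinearGroup.mk'' !![2, 0; 0, 1] (by simpa using h2)) (y := g) ?_
  refine Units.ext ?_
  simp [hg, Matrix.GeneralLinearGroup.mk'', Matrix.nonsingInvUnit, two_mul]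

lemma GL2_lower_mem_commutator (h2 : IsUnit (2 : R)) (g : GL (Fin 2) R) (c : R)
    (hg : (g : Matrix (Fin 2) (Fin 2) R) = !![1, 0; c, 1]) :
    g ∈ commutator (GL (Fin 2) R) := by
  refine mem_commutator_of_mul_eq
    (x := Matrix.GeneralLinearGroup.mk'' !![1, 0; 0, 2] (by simpa using h2)) (y := g) ?_
  refine Units.ext ?_
  simp [hg, Matrix.GeneralLinearGroup.mk'', Matrix.nonsingInvUnit, two_mul]

lemma GL2_diagonal_mem_commutator (g : GL (Fin 2) R) (a : Rˣ)
    (hg : (g : Matrix (Fin 2) (Fin 2) R) = !![(a : R), 0; 0, ((a⁻¹ : Rˣ) : R)]) :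
    g ∈ commutator (GL (Fin 2) R) := by
  refine mem_commutator_of_mul_eq
    (x := Matrix.GeneralLinearGroup.mk'' !![(a : R), 0; 0, 1] (by simp))
    (y := Matrix.GeneralLinearGroup.mk'' !![0, 1; 1, 0] (by simp)) ?_
  refine Units.ext ?_
  simp [hg, Matrix.GeneralLinearGroup.mk'', Matrix.nonsingInvUnit]

/-- A matrix of determinant one whose upper left entry is a unit factors as a lower unitriangular,
a diagonal and an upper unitriangular matrix. -/
lemma GL2_mem_commutator_of_isUnit_apply (h2 : IsUnit (2 : R)) (g : GL (Fin 2) R)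
    (hdet : (g : Matrix (Fin 2) (Fin 2) R).det = 1) (ha : IsUnit (g 0 0)) :
    g ∈ commutator (GL (Fin 2) R) := by
  obtain ⟨a, ha⟩ := ha
  let l : GL (Fin 2) R := Matrix.GeneralLinearGroup.mk'' !![1, 0; g 1 0 * ↑a⁻¹, 1] (by simp)
  let t : GL (Fin 2) R := Matrix.GeneralLinearGroup.mk'' !![(a : R), 0; 0, ↑a⁻¹] (by simp)
  let u : GL (Fin 2) R := Matrix.GeneralLinearGroup.mk'' !![1, ↑a⁻¹ * g 0 1; 0, 1] (by simp)
  have hg : g = l * t * u := by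
    refine Units.ext ?_
    rw [Matrix.det_fin_two, ← ha] at hdet
    have hinv : (a : R) * ↑a⁻¹ = 1 := a.mul_inv
    ext i j
    fin_cases i <;> fin_cases j <;>
      simp [l, t, u, Matrix.GeneralLinearGroup.mk'', Matrix.nonsingInvUnit, ← ha]
    linear_combination (↑a⁻¹ : R) * hdet - g 1 1 * hinv
  rw [hg]
  exact mul_mem (mul_mem (GL2_lower_mem_commutator h2 l _ rfl)
    (GL2_diagonal_mem_commutator t a rfl)) (GL2_upper_mem_commutator h2 u _ rfl)

/-- Over a local ring in which `2` is invertible, every matrix in `GL₂` of determinant one lies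
in the commutator subgroup. -/
lemma GL2_mem_commutator_of_det_eq_one [IsLocalRing R] (h2 : IsUnit (2 : R)) (g : GL (Fin 2) R)
    (hdet : (g : Matrix (Fin 2) (Fin 2) R).det = 1) :
    g ∈ commutator (GL (Fin 2) R) := by
  by_cases ha : IsUnit (g 0 0)
  · exact GL2_mem_commutator_of_isUnit_apply h2 g hdet ha
  let u : GL (Fin 2) R := Matrix.GeneralLinearGroup.mk'' !![1, 1; 0, 1] (by simp)
  have hu : (u : Matrix (Fin 2) (Fin 2) R) = !![1, 1; 0, 1] := rfl
  refine (Subgroup.mul_mem_cancel_left _ (GL2_upper_mem_commutator h2 u 1 rfl)).mp ?_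
  refine GL2_mem_commutator_of_isUnit_apply h2 _
    (by rw [Units.val_mul, Matrix.det_mul, hdet, hu]; simp) ?_
  have hentry : (u * g) 0 0 = g 0 0 + g 1 0 := by
    simp [hu, Matrix.mul_apply]
  rw [hentry]
  by_contra hsum
  have hc : ¬ IsUnit (g 1 0) := fun hc => by
    have := IsLocalRing.nonunits_add (a := g 0 0 + g 1 0) (b := -g 0 0) hsum
      (by simpa [mem_nonunits_iff] using ha)
    exact this (by simpa using hc)
  rw [Matrix.det_fin_two] at hdet
  have hmem : g 0 0 * g 1 1 - g 0 1 * g 1 0 ∈ IsLocalRing.maximalIdeal R :=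
    sub_mem (Ideal.mul_mem_right _ _ ha) (Ideal.mul_mem_left _ _ hc)
  rw [hdet] at hmem
  exact hmem isUnit_one

lemma GL2_ker_det_eq_commutator [IsLocalRing R] (h2 : IsUnit (2 : R)) :
    (Matrix.GeneralLinearGroup.det : GL (Fin 2) R →* Rˣ).ker = commutator (GL (Fin 2) R) := by
  refine le_antisymm (fun g hg => ?_) (Abelianization.commutator_subset_ker _)
  exact GL2_mem_commutator_of_det_eq_one h2 g (congrArg Units.val (MonoidHom.mem_ker.mp hg))

lemma GL2_det_surjective :
    Function.Surjective (Matrix.GeneralLinearGroup.det : GL (Fin 2) R →* Rˣ) := fun a =>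
  ⟨Matrix.GeneralLinearGroup.mk'' !![(a : R), 0; 0, 1] (by simp), Units.ext (by
    simp [Matrix.GeneralLinearGroup.mk'', Matrix.nonsingInvUnit])⟩

end GL2

lemma PadicInt.isUnit_two {p : ℕ} [Fact p.Prime] (hp : Odd p) : IsUnit (2 : ℤ_[p]) := by
  have h : IsUnit ((2 : ℕ) : ℤ_[p]) := by
    rw [PadicInt.isUnit_iff, PadicInt.norm_natCast_eq_one_iff]
    exact hp.coprime_two_right
  exact_mod_cast h

/-- For an odd prime `p`, the determinant homomorphism `det : GL₂(ℤ_p) → ℤ_pˣ` is surjective,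
its kernel is the commutator subgroup of `GL₂(ℤ_p)`, and hence it induces a group
isomorphism from the abelianisation of `GL₂(ℤ_p)` onto `ℤ_pˣ`. -/
theorem abelianization_GL2_padicInt_eq_units (p : ℕ) [Fact p.Prime] (hp : Odd p) :
    Function.Surjective
      (Matrix.GeneralLinearGroup.det : GL (Fin 2) ℤ_[p] →* ℤ_[p]ˣ) ∧
    (Matrix.GeneralLinearGroup.det : GL (Fin 2) ℤ_[p] →* ℤ_[p]ˣ).ker =
      commutator (GL (Fin 2) ℤ_[p]) ∧
    ∃ e : Abelianization (GL (Fin 2) ℤ_[p]) ≃* ℤ_[p]ˣ,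
      ∀ g : GL (Fin 2) ℤ_[p],
        e (Abelianization.of g) = Matrix.GeneralLinearGroup.det g := by
  have hsurj := GL2_det_surjective (R := ℤ_[p])
  have hker := GL2_ker_det_eq_commutator (PadicInt.isUnit_two hp)
  exact ⟨hsurj, hker, (QuotientGroup.quotientMulEquivOfEq hker.symm).trans
    (QuotientGroup.quotientKerEquivOfSurjective _ hsurj), fun g => rfl⟩
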